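/- Fix y = (y₁,y₂,y₃) ∈ ℝ³ with y₃ > 0 and vectors g, ν ∈ ℝ³. Define u^{R,W}ᵢ(x) = Σⱼ Σₖ Tᴿᵢⱼₖ(x,y) νₖ gⱼ − Σⱼ Σₖ Tᴿᵢⱼₖ(x,yᴵ) νᴵₖ gᴵⱼ − [x₃ ∂φᴿ/∂xᵢ(x) − δᵢ₃ φᴿ(x)], where φᴿ(x) = −2 νᴵ₃ Gᴰ[gᴵ](x,yᴵ) + 2 gᴵ₃ Gᴰ[νᴵ](x,yᴵ). Then u^{R,W} satisfies the no-slip condition: u^{R,W}ᵢ(x) = 0 for all i = 1,2,3 and every x = (x₁,x₂,0) with x ≠ yᴵ. -/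

import Mathlib

open Real Finset

noncomputable section

/-- Points in three-dimensional Euclidean space. -/
abbrev E3 := EuclideanSpace ℝ (Fin 3)

/-- Partial derivative `∂f/∂xᵢ` of a scalar field on `ℝ³`. -/
def pd (i : Fin 3) (f : E3 → ℝ) (x : E3) : ℝ :=
  fderiv ℝ f x (EuclideanSpace.single i 1)

/-- Kronecker delta. -/
def kron (i j : Fin 3) : ℝ := if i = j then 1 else 0

/-- Reflected image point `yᴵ = (y₁, y₂, -y₃)`. -/
def reflPt (y : E3) : E3 := (EuclideanSpace.equiv (Fin 3) ℝ).symm ![y 0, y 1, -y 2]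

/-- Reflected vector `fᴵ = (f₁, f₂, -f₃)`. -/
def reflVec (f : Fin 3 → ℝ) : Fin 3 → ℝ := ![f 0, f 1, -f 2]

/-- Harmonic potential of a unit charge, `Gˢ(x,y) = 1/(4π|x-y|)`. -/
def GS (x y : E3) : ℝ := 1 / (4 * π * ‖x - y‖)

/-- Harmonic potential of a unit dipole with orientation `ν`:
`Gᴰ[ν](x,y) = Σᵢ νᵢ ∂/∂yᵢ Gˢ(x,y)`. -/
def GD (ν : Fin 3 → ℝ) (x y : E3) : ℝ := ∑ i, ν i * pd i (fun z => GS x z) y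

/-- Harmonic potential of a unit quadrupole with orientations `ν, κ`:
`G^Q[ν,κ](x,y) = Σᵢ Σⱼ νᵢ κⱼ ∂²/∂yᵢ∂yⱼ Gˢ(x,y)`. -/
def GQ (ν κ : Fin 3 → ℝ) (x y : E3) : ℝ :=
  ∑ i, ∑ j, ν i * κ j * pd i (fun z => pd j (fun w => GS x w) z) y

/-- The rotlet (antisymmetric part of the Stokes doublet)
`Tᴿᵢⱼₖ(x,y) = (1/4π)[-(xⱼ-yⱼ)δᵢₖ/|x-y|³ + (xₖ-yₖ)δᵢⱼ/|x-y|³]`. -/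
def TR (x y : E3) (i j k : Fin 3) : ℝ :=
  (1 / (4 * π)) * (-(x j - y j) * kron i k / ‖x - y‖ ^ 3
    + (x k - y k) * kron i j / ‖x - y‖ ^ 3)

/-- The Papkovich–Neuber potential for the rotlet image system:
`φᴿ(x) = -2 νᴵ₃ Gᴰ[gᴵ](x,yᴵ) + 2 gᴵ₃ Gᴰ[νᴵ](x,yᴵ)`. -/
def phiR (y : E3) (g ν : Fin 3 → ℝ) (x : E3) : ℝ :=
  -2 * reflVec ν 2 * GD (reflVec g) x (reflPt y)
    + 2 * reflVec g 2 * GD (reflVec ν) x (reflPt y)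

/-- The half-space rotlet velocity `u^{R,W}`. -/
def uRW (y : E3) (g ν : Fin 3 → ℝ) (i : Fin 3) (x : E3) : ℝ :=
  (∑ j, ∑ k, TR x y i j k * ν k * g j)
    - (∑ j, ∑ k, TR x (reflPt y) i j k * reflVec ν k * reflVec g j)
    - (x 2 * pd i (phiR y g ν) x - if i = 2 then phiR y g ν x else 0)

theorem pd_GS {x y : E3} (h : x ≠ y) (i : Fin 3) :
    pd i (fun z => GS x z) y = (x i - y i) / (4 * π * ‖x - y‖ ^ 3) := by
  have hn : ‖x - y‖ ≠ 0 := norm_ne_zero_iff.mpr (sub_ne_zero.mpr h)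
  have hsq := ((hasFDerivAt_id y).const_sub x).norm_sq
  have hsqrt := hsq.sqrt (pow_ne_zero 2 hn)
  have hinv := (hasDerivAt_inv (x := √(‖x - y‖ ^ 2))
    (by rwa [Real.sqrt_sq (norm_nonneg _)])).comp_hasFDerivAt y hsqrt
  have hGS : (fun z => GS x z) =
      fun z => (4 * π)⁻¹ * ((fun t : ℝ => t⁻¹) ∘ fun z => √(‖x - id z‖ ^ 2)) z := by
    funext z
    simp [GS, Real.sqrt_sq (norm_nonneg _), mul_comm]
  rw [pd, hGS, (hinv.const_mul (4 * π)⁻¹).fderiv]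
  simp [Real.sqrt_sq (norm_nonneg _), EuclideanSpace.inner_single_right]
  field_simp
  ring

theorem GD_eq {x y : E3} (h : x ≠ y) (ν : Fin 3 → ℝ) :
    GD ν x y = (∑ i, ν i * (x i - y i)) / (4 * π * ‖x - y‖ ^ 3) := by
  simp only [GD, pd_GS h, Finset.sum_div, mul_div_assoc]

theorem norm_sub_reflPt {x : E3} (hx : x 2 = 0) (y : E3) :
    ‖x - reflPt y‖ = ‖x - y‖ := by
  simp [EuclideanSpace.norm_eq, Fin.sum_univ_three, reflPt, hx]

/-- the half-space rotlet `u^{R,W}` satisfies the no-slip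
condition on the plane `x₃ = 0`. -/
theorem rotlet_halfspace_no_slip (y : E3) (hy : 0 < y 2) (g ν : Fin 3 → ℝ) :
    ∀ x : E3, x 2 = 0 → x ≠ reflPt y → ∀ i, uRW y g ν i x = 0 := by
  intro x hx hxy i
  have hn : ‖x - y‖ ≠ 0 := by
    rw [← norm_sub_reflPt hx]
    exact norm_ne_zero_iff.mpr (sub_ne_zero.mpr hxy)
  simp only [uRW, phiR, TR, GD_eq hxy, norm_sub_reflPt hx, hx, Fin.sum_univ_three]
  fin_cases i <;> simp [kron, reflVec, reflPt] <;> field_simp <;> ring
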